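/- arXiv:1907.07308 — 4 statements merged into one kernel-verified Lean document; each statement's English description precedes it below -/
import Mathlib

section
/- Let X be a real Banach space and let A : X → X be Lipschitz-continuous and monotone (for all x₁, x₂ ∈ X and every ε > 0, ‖x₁ - x₂ + ε(A(x₁) - A(x₂))‖ ≥ ‖x₁ - x₂‖). Then for every f ∈ X the equation x + A(x) = f has a unique solution x ∈ X. -/
/-- Continuation step: if `B` is surjective and expansive and `C` is a strict contraction, then
`B + C` is surjective. -/
theorem surjective_add_of_expansive_of_contraction
    {X : Type*} [NormedAddCommGroup X] [CompleteSpace X] {B C : X → X} {K : NNReal}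
    (hB : Function.Surjective B) (hexp : ∀ x y : X, ‖x - y‖ ≤ ‖B x - B y‖)
    (hK : K < 1) (hC : LipschitzWith K C) :
    Function.Surjective fun x => B x + C x := by
  intro f
  choose R hR using hB
  have hcontr : ContractingWith K fun x => R (f - C x) := by
    refine ⟨hK, LipschitzWith.of_dist_le_mul fun x y => ?_⟩
    calc dist (R (f - C x)) (R (f - C y))
        ≤ ‖B (R (f - C x)) - B (R (f - C y))‖ := by
          rw [dist_eq_norm]
          exact hexp _ _
      _ = dist (C x) (C y) := by rw [hR, hR, ← dist_eq_norm, dist_sub_left]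
      _ ≤ K * dist x y := hC.dist_le_mul x y
  refine ⟨hcontr.fixedPoint, ?_⟩
  have hfix : R (f - C hcontr.fixedPoint) = hcontr.fixedPoint := hcontr.fixedPoint_isFixedPt
  have hval := hR (f - C hcontr.fixedPoint)
  rw [hfix] at hval
  exact eq_sub_iff_add_eq.mp hval

/-- Gaponenko's theorem: if `A` is Lipschitz-continuous and monotone on a real Banach
space `X`, then the equation `x + A x = f` has a unique solution for every `f ∈ X`. -/
theorem second_kind_equation_unique_solution
    {X : Type*} [NormedAddCommGroup X] [NormedSpace ℝ X] [CompleteSpace X]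
    (A : X → X) (L : ℝ) (hL : 0 ≤ L)
    (hLip : ∀ x₁ x₂ : X, ‖A x₁ - A x₂‖ ≤ L * ‖x₁ - x₂‖)
    (hMono : ∀ (x₁ x₂ : X) (ε : ℝ), 0 < ε →
      ‖x₁ - x₂ + ε • (A x₁ - A x₂)‖ ≥ ‖x₁ - x₂‖) :
    ∀ f : X, ∃! x : X, x + A x = f := by
  have hexp : ∀ t : ℝ, 0 ≤ t → ∀ x y : X, ‖x - y‖ ≤ ‖(x + t • A x) - (y + t • A y)‖ := by
    intro t ht x y
    rw [add_sub_add_comm, ← smul_sub]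
    rcases ht.eq_or_lt with rfl | ht
    · simp
    · exact hMono x y t ht
  obtain ⟨N, hN⟩ := exists_nat_gt L
  have hNpos : (0 : ℝ) < N := hL.trans_lt hN
  set δ : ℝ := (N : ℝ)⁻¹ with hδ
  have hδpos : 0 < δ := inv_pos.mpr hNpos
  have hδL : δ * L < 1 := by
    rw [hδ, inv_mul_lt_iff₀ hNpos]
    simpa using hN
  have hC : LipschitzWith ⟨δ * L, by positivity⟩ fun x => δ • A x := by
    refine LipschitzWith.of_dist_le_mul fun x y => ?_
    rw [dist_eq_norm, dist_eq_norm, ← smul_sub, norm_smul, Real.norm_of_nonneg hδpos.le]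
    calc δ * ‖A x - A y‖ ≤ δ * (L * ‖x - y‖) := by gcongr; exact hLip x y
      _ = δ * L * ‖x - y‖ := by ring
  have hsurj : ∀ n : ℕ, Function.Surjective fun x => x + ((n : ℝ) * δ) • A x := by
    intro n
    induction n with
    | zero => exact fun g => ⟨g, by simp⟩
    | succ n ih =>
      have hstep := surjective_add_of_expansive_of_contraction ih
        (hexp (n * δ) (by positivity)) (by exact_mod_cast hδL) hC
      convert hstep using 2 with x
      push_cast
      module
  intro f
  obtain ⟨x, hx⟩ := hsurj N f
  have hNδ : (N : ℝ) * δ = 1 := mul_inv_cancel₀ hNpos.ne'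
  simp only [hNδ, one_smul] at hx
  refine ⟨x, hx, fun y hy => ?_⟩
  have hyx := hexp 1 zero_le_one y x
  simp only [one_smul] at hyx
  rw [hx, show y + A y = f from hy, sub_self, norm_zero] at hyx
  exact sub_eq_zero.mp (norm_le_zero_iff.mp hyx)
end

section
/- Let X be a real Banach space and F : X → X Lipschitz-continuous and monotone (for all x₁, x₂ ∈ X and every ε > 0, ‖x₁ - x₂ + ε(F(x₁) - F(x₂))‖ ≥ ‖x₁ - x₂‖). Then the map P : X → X defined by P(x) = x + F(x) is a bijection of X, and its inverse P⁻¹ is Lipschitz-continuous with Lipschitz constant 1, i.e., ‖P⁻¹(z) - P⁻¹(z̄)‖ ≤ ‖z - z̄‖ for all z, z̄ ∈ X. -/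
/-- If `G` is a surjective map that does not decrease distances and `H` is a strict contraction
on a Banach space, then `G + H` is surjective. -/
theorem surjective_add_of_expanding_of_contracting
    {X : Type*} [NormedAddCommGroup X] [CompleteSpace X] {G H : X → X} {K : ℝ}
    (hG : Function.Surjective G) (hGexp : ∀ x y, ‖x - y‖ ≤ ‖G x - G y‖)
    (hK : 0 ≤ K) (hK1 : K < 1) (hH : ∀ x y, ‖H x - H y‖ ≤ K * ‖x - y‖) :
    Function.Surjective (fun x => G x + H x) := by
  obtain ⟨g, hg⟩ := hG.hasRightInverse
  intro z
  have hT : ContractingWith ⟨K, hK⟩ (fun x => g (z - H x)) := by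
    refine ⟨hK1, LipschitzWith.of_dist_le_mul fun x y => ?_⟩
    have h := hGexp (g (z - H x)) (g (z - H y))
    rw [hg, hg, sub_sub_sub_cancel_left, norm_sub_rev (H y)] at h
    rw [dist_eq_norm, dist_eq_norm]
    exact h.trans (hH x y)
  have hx : g (z - H (hT.fixedPoint _)) = hT.fixedPoint _ := hT.fixedPoint_isFixedPt
  refine ⟨hT.fixedPoint _, ?_⟩
  have h := hg (z - H (hT.fixedPoint _))
  rw [hx] at h
  exact eq_sub_iff_add_eq.mp h

/-- If `F` is Lipschitz-continuous and monotone on a real Banach space `X`, then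
`P = id + F` is a bijection of `X` and its inverse is `1`-Lipschitz. -/
theorem id_add_monotone_bijective_inverse_one_lipschitz
    {X : Type*} [NormedAddCommGroup X] [NormedSpace ℝ X] [CompleteSpace X]
    (F : X → X) (L : ℝ) (hL : 0 ≤ L)
    (hLip : ∀ x₁ x₂ : X, ‖F x₁ - F x₂‖ ≤ L * ‖x₁ - x₂‖)
    (hMono : ∀ (x₁ x₂ : X) (ε : ℝ), 0 < ε →
      ‖x₁ - x₂ + ε • (F x₁ - F x₂)‖ ≥ ‖x₁ - x₂‖) :
    Function.Bijective (fun x : X => x + F x) ∧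
    ∀ z z' : X,
      ‖Function.invFun (fun x : X => x + F x) z -
        Function.invFun (fun x : X => x + F x) z'‖ ≤ ‖z - z'‖ := by
  have hexp : ∀ s : ℝ, 0 ≤ s → ∀ x y : X, ‖x - y‖ ≤ ‖(x + s • F x) - (y + s • F y)‖ := by
    intro s hs x y
    rw [add_sub_add_comm, ← smul_sub]
    rcases hs.eq_or_lt with rfl | hs
    · simp
    · exact hMono x y s hs
  obtain ⟨N, hN⟩ := exists_nat_gt L
  have hN0 : (0 : ℝ) < N := hL.trans_lt hN
  have hsurj : ∀ k : ℕ, Function.Surjective (fun x : X => x + ((k : ℝ) / N) • F x) := by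
    intro k
    induction k with
    | zero => intro z; exact ⟨z, by simp⟩
    | succ k ih =>
      have h := surjective_add_of_expanding_of_contracting (H := fun x => (1 / (N : ℝ)) • F x)
        (K := L / N) ih (hexp _ (by positivity)) (by positivity) ((div_lt_one hN0).mpr hN) (by
          intro x y
          rw [← smul_sub, norm_smul, Real.norm_of_nonneg (by positivity)]
          calc 1 / (N : ℝ) * ‖F x - F y‖ ≤ 1 / (N : ℝ) * (L * ‖x - y‖) := by
                gcongr
                exact hLip x y
            _ = L / N * ‖x - y‖ := by ring)
      simpa only [add_assoc, ← add_smul, ← add_div, Nat.cast_succ] using h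
  have hexp1 : ∀ x y : X, ‖x - y‖ ≤ ‖(x + F x) - (y + F y)‖ := by
    simpa using hexp 1 zero_le_one
  have hP : Function.Surjective (fun x : X => x + F x) := by
    simpa [div_self hN0.ne'] using hsurj N
  refine ⟨⟨fun x y hxy => ?_, hP⟩, fun z z' => ?_⟩
  · have h := hexp1 x y
    rw [sub_eq_zero.mpr hxy, norm_zero] at h
    exact sub_eq_zero.mp (norm_le_zero_iff.mp h)
  · have h := Function.rightInverse_invFun hP
    exact (hexp1 _ _).trans_eq (congrArg norm (congrArg₂ (· - ·) (h z) (h z')))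
end

section
/- Let H be a nonempty closed set in a real Banach space X, let T : H → H be continuous, and suppose T^m is a contraction with contraction coefficient α ∈ [0,1) for a positive integer m. Let x* be the unique fixed point of T in H and let x_{k+1} = T(x_k) be the iteration started at some x₀ ∈ H. Then for every k ≥ m, writing h₀ ∈ {0, 1, …, m-1} for the residual of k modulo m, one has ‖x_k - x*‖ ≤ (α^{(k - h₀)/m} / (1 - α)) · ‖x_{m + h₀} - x_{h₀}‖. -/
/-- Iterating a self-map of `H` that is `α`-contracting in norm shrinks the distance to a fixed point
by the factor `α ^ n`. -/
theorem norm_iterate_sub_fixedPoint_le {X : Type*} [SeminormedAddCommGroup X] {H : Set X}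
    {f : X → X} (hmaps : Set.MapsTo f H H) {α : ℝ} (hα0 : 0 ≤ α)
    (hcontr : ∀ x ∈ H, ∀ y ∈ H, ‖f x - f y‖ ≤ α * ‖x - y‖)
    {p : X} (hp : p ∈ H) (hfix : f p = p) {y : X} (hy : y ∈ H) (n : ℕ) :
    ‖f^[n] y - p‖ ≤ α ^ n * ‖y - p‖ := by
  induction n with
  | zero => simp
  | succ n ih =>
    have h := hcontr _ (hmaps.iterate n hy) p hp
    rw [hfix] at h
    rw [Function.iterate_succ_apply', pow_succ', mul_assoc]
    exact h.trans (mul_le_mul_of_nonneg_left ih hα0)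

/-- The distance to a fixed point of an `α`-contracting map is controlled by one displacement. -/
theorem norm_sub_fixedPoint_le_div {X : Type*} [SeminormedAddCommGroup X] {H : Set X}
    {f : X → X} {α : ℝ} (hα1 : α < 1)
    (hcontr : ∀ x ∈ H, ∀ y ∈ H, ‖f x - f y‖ ≤ α * ‖x - y‖)
    {p : X} (hp : p ∈ H) (hfix : f p = p) {y : X} (hy : y ∈ H) :
    ‖y - p‖ ≤ ‖f y - y‖ / (1 - α) := by
  have h := hcontr y hy p hp
  rw [hfix] at h
  have htri := norm_sub_le_norm_sub_add_norm_sub y (f y) p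
  rw [norm_sub_rev y (f y)] at htri
  rw [le_div_iff₀ (sub_pos.mpr hα1)]
  linarith

/-- Error estimate for the iteration `x_{k+1} = T x_k` when `T^[m]` is a contraction
with coefficient `α` on a nonempty closed subset `H`: for `k ≥ m`, with `h₀ = k % m`,
`‖x_k - x*‖ ≤ α^((k - h₀)/m) / (1 - α) · ‖x_{m + h₀} - x_{h₀}‖`. -/
theorem iterate_contraction_error_estimate
    {X : Type*} [NormedAddCommGroup X] [NormedSpace ℝ X] [CompleteSpace X]
    (H : Set X) (hne : H.Nonempty) (hcl : IsClosed H)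
    (T : X → X) (hmaps : Set.MapsTo T H H) (hcont : ContinuousOn T H)
    (m : ℕ) (hm : 0 < m) (α : ℝ) (hα0 : 0 ≤ α) (hα1 : α < 1)
    (hcontr : ∀ x ∈ H, ∀ y ∈ H, ‖T^[m] x - T^[m] y‖ ≤ α * ‖x - y‖)
    (xs : X) (hxsH : xs ∈ H) (hfix : T xs = xs)
    (huniq : ∀ y ∈ H, T y = y → y = xs)
    (x₀ : X) (hx₀ : x₀ ∈ H)
    (k : ℕ) (hk : m ≤ k) :
    ‖T^[k] x₀ - xs‖ ≤
      α ^ ((k - k % m) / m) / (1 - α) * ‖T^[m + k % m] x₀ - T^[k % m] x₀‖ := by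
  have hmapsm : Set.MapsTo T^[m] H H := hmaps.iterate m
  have hfixm : T^[m] xs = xs := Function.iterate_fixed hfix m
  have hyH : T^[k % m] x₀ ∈ H := hmaps.iterate (k % m) hx₀
  have hq : (k - k % m) / m = k / m := by
    rw [← Nat.div_eq_sub_mod_div]
  have hk_iter : T^[k] x₀ = (T^[m])^[k / m] (T^[k % m] x₀) := by
    rw [← Function.iterate_mul, ← Function.iterate_add_apply, Nat.div_add_mod]
  rw [hq, hk_iter, Function.iterate_add_apply, div_mul_eq_mul_div, mul_div_assoc]
  exact (norm_iterate_sub_fixedPoint_le hmapsm hα0 hcontr hxsH hfixm hyH _).trans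
    (mul_le_mul_of_nonneg_left (norm_sub_fixedPoint_le_div hα1 hcontr hxsH hfixm hyH)
      (pow_nonneg hα0 _))
end

section
/- Let M ≥ 0 be a real number and m a positive integer such that α := M^m / √((m-1)!) < 1. For each nonnegative integer h₀ define R_{m,h₀} = Σ_{j=1}^{m} M^{h₀+j} / √((h₀+j-1)!). Then R_{m,h₀+1} ≤ R_{m,h₀} for every h₀ ≥ 0; in particular, for h₀ ∈ {0, 1, …, m-1} the maximum of R_{m,h₀} is attained at h₀ = 0 and equals C_m := M^m/√((m-1)!) + M^{m-1}/√((m-2)!) + ⋯ + M. -/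
/-- If `M ^ m < √((m-1)!)`, then `M ^ (k+1) / √(k!)` does not increase when `k` is shifted
by `m`. -/
theorem pow_div_sqrt_factorial_add_le {M : ℝ} (hM : 0 ≤ M) {m : ℕ}
    (hα : M ^ m / √((m - 1).factorial : ℝ) < 1) (h : ℕ) :
    M ^ (h + m + 1) / √((h + m).factorial : ℝ) ≤ M ^ (h + 1) / √(h.factorial : ℝ) := by
  have sqrt_pos (n : ℕ) : 0 < √(n.factorial : ℝ) :=
    Real.sqrt_pos.2 (mod_cast n.factorial_pos)
  have hpow : M ^ m ≤ √((m - 1).factorial : ℝ) := ((div_lt_one (sqrt_pos _)).1 hα).le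
  have hfact : h.factorial * (m - 1).factorial ≤ (h + m).factorial :=
    (Nat.le_of_dvd (Nat.factorial_pos _) (Nat.factorial_mul_factorial_dvd_factorial_add _ _)).trans
      (Nat.factorial_le (by omega))
  have hsqrt : M ^ m * √(h.factorial : ℝ) ≤ √((h + m).factorial : ℝ) := by
    calc M ^ m * √(h.factorial : ℝ)
        ≤ √((m - 1).factorial : ℝ) * √(h.factorial : ℝ) := by gcongr
      _ = √((h.factorial * (m - 1).factorial : ℕ) : ℝ) := by
        rw [← Real.sqrt_mul (Nat.cast_nonneg _), Nat.cast_mul, mul_comm]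
      _ ≤ √((h + m).factorial : ℝ) := Real.sqrt_le_sqrt (mod_cast hfact)
  rw [div_le_div_iff₀ (sqrt_pos _) (sqrt_pos _)]
  calc M ^ (h + m + 1) * √(h.factorial : ℝ)
      = M ^ (h + 1) * (M ^ m * √(h.factorial : ℝ)) := by ring
    _ ≤ M ^ (h + 1) * √((h + m).factorial : ℝ) := by gcongr

/-- A sum over a window of length `m` does not increase when the window is shifted by one,
provided the entering term is at most the leaving one. -/
theorem sum_range_shift_le {a : ℕ → ℝ} {m h : ℕ} (ha : a (h + m) ≤ a h) :
    ∑ j ∈ Finset.range m, a (h + 1 + j) ≤ ∑ j ∈ Finset.range m, a (h + j) := by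
  have h₁ := Finset.sum_range_succ (fun j => a (h + j)) m
  have h₂ := Finset.sum_range_succ' (fun j => a (h + j)) m
  simp only [add_zero, ← add_assoc, add_right_comm h _ 1] at h₁ h₂
  linarith

/-- With `R_{m,h₀} = Σ_{j=1}^{m} M^{h₀+j} / √((h₀+j-1)!)` (written below as a sum over
`j ∈ range m` of `M^{h₀+j+1} / √((h₀+j)!)`), if `α = M^m/√((m-1)!) < 1`, then `R_{m,h₀}`
is nonincreasing in `h₀`; in particular for `h₀ ∈ {0,…,m-1}` its maximum is attained at
`h₀ = 0`, where it equals `C_m = M^m/√((m-1)!) + M^{m-1}/√((m-2)!) + ⋯ + M`. -/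
theorem R_sum_antitone_max_at_zero
    (M : ℝ) (hM : 0 ≤ M) (m : ℕ) (hm : 0 < m)
    (hα : M ^ m / Real.sqrt (Nat.factorial (m - 1) : ℝ) < 1) :
    (∀ h₀ : ℕ,
      (∑ j ∈ Finset.range m,
          M ^ (h₀ + 1 + j + 1) / Real.sqrt (Nat.factorial (h₀ + 1 + j) : ℝ))
        ≤ ∑ j ∈ Finset.range m,
            M ^ (h₀ + j + 1) / Real.sqrt (Nat.factorial (h₀ + j) : ℝ)) ∧
    (∀ h₀ : ℕ, h₀ ≤ m - 1 →
      (∑ j ∈ Finset.range m,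
          M ^ (h₀ + j + 1) / Real.sqrt (Nat.factorial (h₀ + j) : ℝ))
        ≤ ∑ j ∈ Finset.range m, M ^ (j + 1) / Real.sqrt (Nat.factorial j : ℝ)) := by
  have step (h : ℕ) := sum_range_shift_le
    (a := fun k => M ^ (k + 1) / √(k.factorial : ℝ)) (pow_div_sqrt_factorial_add_le hM hα h)
  refine ⟨step, fun h₀ _ => ?_⟩
  simpa using antitone_nat_of_succ_le
    (f := fun h => ∑ j ∈ Finset.range m, M ^ (h + j + 1) / √((h + j).factorial : ℝ))
    step (Nat.zero_le h₀)
end
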